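/- Let M be any set of monomials of degree t in S, and for 0 ≤ i ≤ t set d_i = |M^i| (with d_{−1} = 0). Then for every 0 ≤ i ≤ t+1, |(S_1·M)^i| ≥ max{ d_i^{<n−2>}, d_{i−1} }. -/

import Mathlib

open scoped Classical
open Finset

noncomputable section

/-- The monomials of degree `t` in `n` variables, identified with exponent vectors. -/
def degMon (n t : ℕ) : Finset (Fin n → ℕ) := Finset.Nat.antidiagonalTuple n t

/-- The exponent of `x_1` in a monomial. -/
def x1exp {n : ℕ} (m : Fin n → ℕ) : ℕ := if h : 0 < n then m ⟨0, h⟩ else 0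

/-- `lexLt u v` : `u` is lexicographically smaller than `v` as monomials
(with `x_1 > x_2 > ... > x_n`), i.e. `v > u`. -/
def lexLt {n : ℕ} (u v : Fin n → ℕ) : Prop :=
  ∃ i : Fin n, (∀ j : Fin n, j < i → u j = v j) ∧ u i < v i

/-- `M` is a lexsegment set inside the ground set `G` of monomials. -/
def IsLexSeg {n : ℕ} (G M : Finset (Fin n → ℕ)) : Prop :=
  M ⊆ G ∧ ∀ m ∈ M, ∀ v ∈ G, lexLt m v → v ∈ M

/-- The lexsegment set consisting of the top `d` monomials of `G` in the lex order. -/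
def lexSeg {n : ℕ} (G : Finset (Fin n → ℕ)) (d : ℕ) : Finset (Fin n → ℕ) :=
  G.filter (fun m => (G.filter (fun v => m = v ∨ lexLt m v)).card ≤ d)

/-- `S_1 · M` : all monomials `u * m` with `u` a variable and `m ∈ M`. -/
def S1mul (n : ℕ) (M : Finset (Fin n → ℕ)) : Finset (Fin n → ℕ) :=
  Finset.univ.biUnion (fun i : Fin n => M.image (fun m => m + Pi.single i 1))

/-- `S'_1 · M` : all monomials `x_i * m` with `2 ≤ i ≤ n` and `m ∈ M`. -/
def S1'mul (n : ℕ) (M : Finset (Fin n → ℕ)) : Finset (Fin n → ℕ) :=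
  (Finset.univ.filter (fun i : Fin n => (i : ℕ) ≠ 0)).biUnion
    (fun i => M.image (fun m => m + Pi.single i 1))

/-- `d^{<k>}` : the number of monomials obtained by multiplying each member of the
lexsegment set of `d` monomials of a fixed degree in `k+1` variables by each of the
`k+1` variables.  (We realize it in degree `d`, where the lexsegment set exists;
the number is independent of the chosen degree.  Also `0^{<k>} = 0`.) -/
def growth (d k : ℕ) : ℕ := (S1mul (k + 1) (lexSeg (degMon (k + 1) d) d)).card

/-- The monomials of `R_t` where `R = S/(x_1^a)` : degree-`t` monomials whose
`x_1`-exponent is at most `a - 1`. -/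
def RMon (n a t : ℕ) : Finset (Fin n → ℕ) :=
  (degMon n t).filter (fun m => x1exp m < a)

/-- `R_1 · M` : the monomials of `S_1 · M` not divisible by `x_1^a`. -/
def R1mul (n a : ℕ) (M : Finset (Fin n → ℕ)) : Finset (Fin n → ℕ) :=
  (S1mul n M).filter (fun m => x1exp m < a)

/-- `d_{n,t}` : the size of `R_1 · L` for the lexsegment set `L` of `d` monomials in `R_t`. -/
def dnt (n a t d : ℕ) : ℕ := (R1mul n a (lexSeg (RMon n a t) d)).card

/-- `M^i` : the monomials of `M` divisible by `x_1^i` but not by `x_1^{i+1}`. -/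
def comp {n : ℕ} (M : Finset (Fin n → ℕ)) (i : ℕ) : Finset (Fin n → ℕ) :=
  M.filter (fun m => x1exp m = i)

/-- `I(M)` : the smallest `i` such that `M^i ≠ ∅`. -/
def Imon {n : ℕ} (M : Finset (Fin n → ℕ)) : ℕ := sInf {i | (comp M i).Nonempty}

/-- `M` is Gotzmann in `S_t`. -/
def GotzmannS (n t : ℕ) (M : Finset (Fin n → ℕ)) : Prop :=
  (S1mul n (lexSeg (degMon n t) M.card)).card = (S1mul n M).card

/-- `M` is Gotzmann in `R_t`, `R = S/(x_1^a)`. -/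
def GotzmannR (n a t : ℕ) (M : Finset (Fin n → ℕ)) : Prop :=
  (R1mul n a (lexSeg (RMon n a t) M.card)).card = (R1mul n a M).card

/-- The monomials of degree `t` of `S' = F[x_2,...,x_n]`, viewed inside the `n`
variables as the monomials with `x_1`-exponent `0`. -/
def SpMon (n t : ℕ) : Finset (Fin n → ℕ) :=
  (degMon n t).filter (fun m => x1exp m = 0)

/-- `M` is Gotzmann in `S' = F[x_2,...,x_n]` (in degree `t`). -/
def GotzmannSp (n t : ℕ) (M : Finset (Fin n → ℕ)) : Prop :=
  (S1'mul n (lexSeg (SpMon n t) M.card)).card = (S1'mul n M).card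

/-- Dividing a monomial by the pure power of `x_1` it contains: set the first exponent to `0`. -/
def clearX1 {n : ℕ} (m : Fin n → ℕ) : Fin n → ℕ :=
  fun j => if (j : ℕ) = 0 then 0 else m j

/-- `M^i / x_1` : the monomials `m` of `S'` with `m * x_1^i ∈ M^i` (applied to `M = M^i`). -/
def divX1 {n : ℕ} (M : Finset (Fin n → ℕ)) : Finset (Fin n → ℕ) :=
  M.image clearX1

/-- `u · M` : the monomials `u * m` with `m ∈ M`. -/
def mulMon {n : ℕ} (u : Fin n → ℕ) (M : Finset (Fin n → ℕ)) : Finset (Fin n → ℕ) :=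
  M.image (fun m => u + m)

/-- The set `B` of degree-`t` monomials of `S` divisible by `x_1^a`. -/
def Bset (n a t : ℕ) : Finset (Fin n → ℕ) :=
  (degMon n t).filter (fun m => a ≤ x1exp m)

/-! ### Helpers -/

def ee {N : ℕ} (i : Fin N) : Fin N → ℕ := Pi.single i 1

lemma ee_apply {N : ℕ} (i k : Fin N) : ee i k = if k = i then 1 else 0 := by
  simp [ee, Pi.single_apply]

lemma mem_degMon {N t : ℕ} {m : Fin N → ℕ} : m ∈ degMon N t ↔ ∑ k, m k = t := by
  simp [degMon, Finset.Nat.mem_antidiagonalTuple]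

lemma mem_S1mul {N : ℕ} {M : Finset (Fin N → ℕ)} {v : Fin N → ℕ} :
    v ∈ S1mul N M ↔ ∃ i, ∃ m ∈ M, m + ee i = v := by
  simp [S1mul, ee]

lemma sum_add_ee {N : ℕ} (m : Fin N → ℕ) (i : Fin N) :
    ∑ k, (m + ee i) k = ∑ k, m k + 1 := by
  simp [Finset.sum_add_distrib, ee_apply]

/-! ### Rank lemma -/

lemma rank_image {α : Type*} (A : Finset α) (f : α → ℕ) (hf : Set.InjOn f A) :
    A.image (fun a => (A.filter (fun b => f b < f a)).card) = Finset.range A.card := by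
  apply Finset.eq_of_subset_of_card_le
  · intro y hy
    simp only [Finset.mem_image] at hy
    obtain ⟨a, ha, rfl⟩ := hy
    rw [Finset.mem_range]
    apply Finset.card_lt_card
    refine ⟨Finset.filter_subset _ _, fun h => ?_⟩
    have := h ha
    simp at this
  · rw [Finset.card_range, Finset.card_image_of_injOn]
    have key : ∀ a ∈ A, ∀ b ∈ A, f a < f b →
        (A.filter (fun c => f c < f a)).card < (A.filter (fun c => f c < f b)).card := by
      intro a ha b hb hab
      apply Finset.card_lt_card
      refine ⟨fun c hc => ?_, fun h => ?_⟩
      · simp only [Finset.mem_filter] at hc ⊢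
        exact ⟨hc.1, hc.2.trans hab⟩
      · have : a ∈ A.filter (fun c => f c < f b) := by simp [ha, hab]
        have := h this
        simp at this
    intro a ha b hb hab
    apply hf ha hb
    simp only at hab
    rcases lt_trichotomy (f a) (f b) with h | h | h
    · have := key a ha b hb h; omega
    · exact h
    · have := key b hb a ha h; omega

/-! ### Pair compression -/

def agr {N : ℕ} (i j : Fin N) (m m' : Fin N → ℕ) : Prop := ∀ k, k ≠ i → k ≠ j → m' k = m k

def fib {N : ℕ} (i j : Fin N) (M : Finset (Fin N → ℕ)) (m : Fin N → ℕ) : Finset (Fin N → ℕ) :=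
  M.filter (fun m' => agr i j m m')

def rk {N : ℕ} (i j : Fin N) (M : Finset (Fin N → ℕ)) (m : Fin N → ℕ) : ℕ :=
  ((fib i j M m).filter (fun m' => m' j < m j)).card

def sg {N : ℕ} (i j : Fin N) (M : Finset (Fin N → ℕ)) (m : Fin N → ℕ) : Fin N → ℕ :=
  fun k => if k = j then rk i j M m else if k = i then m i + m j - rk i j M m else m k

def pcmp {N : ℕ} (i j : Fin N) (M : Finset (Fin N → ℕ)) : Finset (Fin N → ℕ) :=
  M.image (sg i j M)

lemma sum_split {N : ℕ} {i j : Fin N} (hij : i ≠ j) (f : Fin N → ℕ) :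
    ∑ k, f k = f i + f j + ∑ k ∈ (Finset.univ.erase i).erase j, f k := by
  rw [← Finset.add_sum_erase Finset.univ f (Finset.mem_univ i),
    ← Finset.add_sum_erase (Finset.univ.erase i) f (a := j) (by simp [hij.symm])]
  ring

lemma agr_sum {N : ℕ} {i j : Fin N} (hij : i ≠ j) {m m' : Fin N → ℕ} (h : agr i j m m')
    (hs : ∑ k, m' k = ∑ k, m k) : m' i + m' j = m i + m j := by
  rw [sum_split hij, sum_split hij m] at hs
  have : ∑ k ∈ (Finset.univ.erase i).erase j, m' k = ∑ k ∈ (Finset.univ.erase i).erase j, m k := by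
    apply Finset.sum_congr rfl
    intro k hk
    simp at hk
    exact h k hk.2 hk.1
  omega

lemma agr_eq {N : ℕ} {i j : Fin N} (hij : i ≠ j) {m m' : Fin N → ℕ} (h : agr i j m m')
    (hs : ∑ k, m' k = ∑ k, m k) (hj : m' j = m j) : m' = m := by
  have := agr_sum hij h hs
  funext k
  by_cases hi : k = i
  · subst hi; omega
  by_cases hj' : k = j
  · subst hj'; omega
  exact h k hi hj'

lemma agr_trans {N : ℕ} {i j : Fin N} {a b c : Fin N → ℕ} (h : agr i j a b) (h' : agr i j b c) :
    agr i j a c := fun k h1 h2 => (h' k h1 h2).trans (h k h1 h2)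

lemma agr_symm {N : ℕ} {i j : Fin N} {a b : Fin N → ℕ} (h : agr i j a b) :
    agr i j b a := fun k h1 h2 => (h k h1 h2).symm

lemma fib_congr {N : ℕ} {i j : Fin N} (M : Finset (Fin N → ℕ)) {a b : Fin N → ℕ}
    (h : agr i j a b) : fib i j M a = fib i j M b := by
  unfold fib
  apply Finset.filter_congr
  intro x _
  exact ⟨fun h' => agr_trans (agr_symm h) h', fun h' => agr_trans h h'⟩

lemma fib_injOn {N t : ℕ} {i j : Fin N} (hij : i ≠ j) {M : Finset (Fin N → ℕ)}
    (hM : M ⊆ degMon N t) (m : Fin N → ℕ) : Set.InjOn (fun x : Fin N → ℕ => x j) (fib i j M m) := by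
  intro a ha b hb hab
  simp only [fib, Finset.coe_filter, Set.mem_ofPred_eq] at ha hb
  have h1 := mem_degMon.1 (hM ha.1)
  have h2 := mem_degMon.1 (hM hb.1)
  exact agr_eq hij (agr_trans (agr_symm hb.2) ha.2) (by omega) hab

lemma rk_le {N t : ℕ} {i j : Fin N} (hij : i ≠ j) {M : Finset (Fin N → ℕ)}
    (hM : M ⊆ degMon N t) (m : Fin N → ℕ) : rk i j M m ≤ m j := by
  unfold rk
  calc _ ≤ (Finset.range (m j)).card := by
        apply Finset.card_le_card_of_injOn (fun x => x j)
        · intro x hx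
          simp at hx
          simpa using hx.2
        · exact (fib_injOn hij hM m).mono (by intro x hx; simp at hx; simpa using hx.1)
    _ = _ := by simp

lemma sg_agr {N : ℕ} (i j : Fin N) (M : Finset (Fin N → ℕ)) (m : Fin N → ℕ) :
    agr i j m (sg i j M m) := by
  intro k h1 h2
  simp [sg, h1, h2]

lemma sg_sum {N t : ℕ} {i j : Fin N} (hij : i ≠ j) {M : Finset (Fin N → ℕ)}
    (hM : M ⊆ degMon N t) (m : Fin N → ℕ) : ∑ k, sg i j M m k = ∑ k, m k := by
  have h := rk_le hij hM m
  rw [sum_split hij, sum_split hij m]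
  have : ∑ k ∈ (Finset.univ.erase i).erase j, sg i j M m k
      = ∑ k ∈ (Finset.univ.erase i).erase j, m k := by
    apply Finset.sum_congr rfl
    intro k hk
    simp at hk
    exact sg_agr i j M m k hk.2 hk.1
  rw [this]
  simp [sg, hij]
  omega

lemma fib_rank {N t : ℕ} {i j : Fin N} (hij : i ≠ j) {M : Finset (Fin N → ℕ)}
    (hM : M ⊆ degMon N t) (m : Fin N → ℕ) :
    (fib i j M m).image (rk i j M) = Finset.range (fib i j M m).card := by
  rw [← rank_image (fib i j M m) (fun x => x j) (fib_injOn hij hM m)]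
  apply Finset.image_congr
  intro a ha
  simp only [fib, Finset.coe_filter, Set.mem_ofPred_eq] at ha
  simp only [rk]
  rw [fib_congr M ha.2]

lemma mem_cmp {N t : ℕ} {i j : Fin N} (hij : i ≠ j) {M : Finset (Fin N → ℕ)}
    (hM : M ⊆ degMon N t) (m : Fin N → ℕ) :
    m ∈ pcmp i j M ↔ m ∈ degMon N t ∧ m j < (fib i j M m).card := by
  constructor
  · intro h
    simp only [pcmp, Finset.mem_image] at h
    obtain ⟨a, ha, rfl⟩ := h
    refine ⟨mem_degMon.2 ((sg_sum hij hM a).trans (mem_degMon.1 (hM ha))), ?_⟩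
    rw [← fib_congr M (sg_agr i j M a)]
    have : rk i j M a ∈ (fib i j M a).image (rk i j M) := by
      apply Finset.mem_image_of_mem
      exact Finset.mem_filter.2 ⟨ha, fun _ _ _ => rfl⟩
    rw [fib_rank hij hM] at this
    simpa [sg] using this
  · rintro ⟨h1, h2⟩
    have : m j ∈ (fib i j M m).image (rk i j M) := by
      rw [fib_rank hij hM]; simpa using h2
    simp only [Finset.mem_image] at this
    obtain ⟨a, ha, har⟩ := this
    simp only [fib, Finset.mem_filter] at ha
    simp only [pcmp, Finset.mem_image]
    refine ⟨a, ha.1, ?_⟩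
    apply agr_eq hij (agr_trans ha.2 (sg_agr i j M a))
    · rw [sg_sum hij hM, mem_degMon.1 h1, mem_degMon.1 (hM ha.1)]
    · simp [sg, har]

lemma rk_injOn {N t : ℕ} {i j : Fin N} (hij : i ≠ j) {M : Finset (Fin N → ℕ)}
    (hM : M ⊆ degMon N t) (m : Fin N → ℕ) : Set.InjOn (rk i j M) (fib i j M m) := by
  apply Finset.injOn_of_card_image_eq
  rw [fib_rank hij hM]
  simp

lemma card_cmp {N t : ℕ} {i j : Fin N} (hij : i ≠ j) {M : Finset (Fin N → ℕ)}
    (hM : M ⊆ degMon N t) : (pcmp i j M).card = M.card := by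
  apply Finset.card_image_of_injOn
  intro a ha b hb hab
  have h1 : agr i j b a := by
    have h2 := sg_agr i j M a
    rw [hab] at h2
    exact agr_trans (sg_agr i j M b) (agr_symm h2)
  apply rk_injOn hij hM b
  · simp only [fib, Finset.coe_filter, Set.mem_ofPred_eq]; exact ⟨ha, h1⟩
  · simp only [fib, Finset.coe_filter, Set.mem_ofPred_eq]; exact ⟨hb, fun _ _ _ => rfl⟩
  · have := congrFun hab j
    simpa [sg] using this

lemma S1mul_sub {N t : ℕ} {M : Finset (Fin N → ℕ)} (hM : M ⊆ degMon N t) :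
    S1mul N M ⊆ degMon N (t+1) := by
  intro v hv
  obtain ⟨i, m, hm, rfl⟩ := mem_S1mul.1 hv
  rw [mem_degMon, sum_add_ee, mem_degMon.1 (hM hm)]

lemma add_ee_inj {N : ℕ} (i : Fin N) : Function.Injective (fun m : Fin N → ℕ => m + ee i) :=
  fun a b h => by simpa using h

lemma S1mul_cmp {N t : ℕ} {i j : Fin N} (hij : i ≠ j) {M : Finset (Fin N → ℕ)}
    (hM : M ⊆ degMon N t) : S1mul N (pcmp i j M) ⊆ pcmp i j (S1mul N M) := by
  intro v hv
  obtain ⟨k, m, hm, rfl⟩ := mem_S1mul.1 hv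
  rw [mem_cmp hij hM] at hm
  rw [mem_cmp hij (S1mul_sub hM)]
  refine ⟨by rw [mem_degMon, sum_add_ee, mem_degMon.1 hm.1], ?_⟩
  have himg : (fib i j M m).image (fun x => x + ee k) ⊆ fib i j (S1mul N M) (m + ee k) := by
    intro x hx
    simp only [Finset.mem_image, fib, Finset.mem_filter] at hx
    obtain ⟨a, ⟨ha, hag⟩, rfl⟩ := hx
    simp only [fib, Finset.mem_filter]
    refine ⟨mem_S1mul.2 ⟨k, a, ha, rfl⟩, fun l h1 h2 => ?_⟩
    simp [hag l h1 h2]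
  by_cases hk : k = j
  · subst hk
    have hne : (fib i k M m).Nonempty := by
      rw [← Finset.card_pos]; omega
    obtain ⟨a, ha, hmax⟩ := Finset.exists_max_image (fib i k M m) (fun x => x i) hne
    have hnot : a + ee i ∉ (fib i k M m).image (fun x => x + ee k) := by
      intro h
      simp only [Finset.mem_image] at h
      obtain ⟨b, hb, hab⟩ := h
      have := congrFun hab i
      simp [ee_apply, hij] at this
      have := hmax b hb
      omega
    have hin : a + ee i ∈ fib i k (S1mul N M) (m + ee k) := by
      simp only [fib, Finset.mem_filter] at ha ⊢
      refine ⟨mem_S1mul.2 ⟨i, a, ha.1, rfl⟩, fun l h1 h2 => ?_⟩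
      simp [ha.2 l h1 h2, ee_apply, h1, h2]
    have h3 := Finset.card_le_card (Finset.insert_subset hin himg)
    rw [Finset.card_insert_of_notMem hnot, Finset.card_image_of_injective _ (add_ee_inj k)] at h3
    have : (m + ee k) k = m k + 1 := by simp [ee_apply]
    omega
  · have h3 := Finset.card_le_card himg
    rw [Finset.card_image_of_injective _ (add_ee_inj k)] at h3
    have : (m + ee k) j = m j := by simp [ee_apply, Ne.symm hk]
    omega

/-! ### Strongly stable sets -/

def Stab {N : ℕ} (M : Finset (Fin N → ℕ)) : Prop :=
  ∀ (w : Fin N → ℕ) (i j : Fin N), i < j → w + ee j ∈ M → w + ee i ∈ M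

def wt {N : ℕ} (m : Fin N → ℕ) : ℕ := ∑ k : Fin N, (k : ℕ) * m k

lemma wt_sg {N t : ℕ} {i j : Fin N} (hij : i < j) {M : Finset (Fin N → ℕ)}
    (hM : M ⊆ degMon N t) (m : Fin N → ℕ) :
    wt (sg i j M m) ≤ wt m ∧ (wt (sg i j M m) = wt m → rk i j M m = m j) := by
  have h := rk_le hij.ne hM m
  unfold wt
  rw [sum_split hij.ne, sum_split hij.ne (fun k => (k : ℕ) * m k)]
  have : ∑ k ∈ (Finset.univ.erase i).erase j, (k : ℕ) * sg i j M m k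
      = ∑ k ∈ (Finset.univ.erase i).erase j, (k : ℕ) * m k := by
    apply Finset.sum_congr rfl
    intro k hk
    simp at hk
    rw [sg_agr i j M m k hk.2 hk.1]
  rw [this]
  have e1 : sg i j M m j = rk i j M m := by simp [sg]
  have e2 : sg i j M m i = m i + m j - rk i j M m := by simp [sg, hij.ne]
  rw [e1, e2]
  obtain ⟨d, hd⟩ := Nat.exists_eq_add_of_le h
  have e3 : m i + m j - rk i j M m = m i + d := by omega
  rw [e3, hd]
  have hij' : (i : ℕ) < j := hij
  generalize rk i j M m = r
  constructor
  · nlinarith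
  · intro h
    have : (i : ℕ) * d = j * d := by nlinarith
    rcases Nat.eq_zero_or_pos d with h0 | h0
    · omega
    · have := Nat.eq_of_mul_eq_mul_right h0 this
      omega

lemma exists_stab {N t : ℕ} (M : Finset (Fin N → ℕ)) (hM : M ⊆ degMon N t) :
    ∃ M' ⊆ degMon N t, Stab M' ∧ M'.card = M.card ∧ (S1mul N M').card ≤ (S1mul N M).card := by
  obtain ⟨A, hA, hmin⟩ := Finset.exists_min_image
    ((degMon N t).powerset.filter
      (fun A => A.card = M.card ∧ (S1mul N A).card ≤ (S1mul N M).card))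
    (fun A => ∑ m ∈ A, wt m) ⟨M, by simp [hM]⟩
  simp only [Finset.mem_filter, Finset.mem_powerset] at hA hmin
  obtain ⟨hAs, hAc, hAS⟩ := hA
  refine ⟨A, hAs, ?_, hAc, hAS⟩
  intro w i j hij hw
  have h1 := hmin (pcmp i j A) ⟨fun x hx => ((mem_cmp hij.ne hAs x).1 hx).1,
    (card_cmp hij.ne hAs).trans hAc, by
      refine le_trans ?_ hAS
      rw [← card_cmp hij.ne (S1mul_sub hAs)]
      exact Finset.card_le_card (S1mul_cmp hij.ne hAs)⟩
  have hinj : Set.InjOn (sg i j A) A :=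
    Finset.injOn_of_card_image_eq (card_cmp hij.ne hAs)
  unfold pcmp at h1
  rw [Finset.sum_image hinj] at h1
  have h2 : ∑ m ∈ A, wt (sg i j A m) = ∑ m ∈ A, wt m :=
    le_antisymm (Finset.sum_le_sum fun m _ => (wt_sg hij hAs m).1) h1
  rw [Finset.sum_eq_sum_iff_of_le (fun m _ => (wt_sg hij hAs m).1)] at h2
  have h3 : ∀ m ∈ A, rk i j A m = m j := fun m hm => (wt_sg hij hAs m).2 (h2 m hm)
  have h4 : rk i j A (w + ee j) ∈ (fib i j A (w + ee j)).image (rk i j A) :=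
    Finset.mem_image_of_mem _ (Finset.mem_filter.2 ⟨hw, fun _ _ _ => rfl⟩)
  rw [h3 _ hw, fib_rank hij.ne hAs] at h4
  have h5 : w j ∈ (fib i j A (w + ee j)).image (rk i j A) := by
    rw [fib_rank hij.ne hAs]
    simp [ee_apply] at h4 ⊢
    omega
  simp only [Finset.mem_image, fib, Finset.mem_filter] at h5
  obtain ⟨a, ⟨ha, hag⟩, har⟩ := h5
  rw [h3 a ha] at har
  have : a = w + ee i := by
    apply agr_eq hij.ne
    · intro k hk1 hk2
      rw [hag k hk1 hk2]
      simp [ee_apply, hk1, hk2]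
    · have e1 := mem_degMon.1 (hAs ha)
      have e2 := mem_degMon.1 (hAs hw)
      rw [sum_add_ee] at e2 ⊢
      omega
    · rw [har]; simp [ee_apply, hij.ne']
  rwa [← this]

/-! ### Lex order -/

lemma lexLt_irrefl {N : ℕ} (u : Fin N → ℕ) : ¬ lexLt u u := by
  rintro ⟨i, _, h⟩; omega

lemma lexLt_trans {N : ℕ} {u v w : Fin N → ℕ} (h : lexLt u v) (h' : lexLt v w) : lexLt u w := by
  obtain ⟨i, hi, hi'⟩ := h
  obtain ⟨j, hj, hj'⟩ := h'
  rcases lt_trichotomy i j with h | h | h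
  · exact ⟨i, fun k hk => (hi k hk).trans (hj k (hk.trans h)), by rw [← hj i h]; exact hi'⟩
  · subst h
    exact ⟨i, fun k hk => (hi k hk).trans (hj k hk), hi'.trans hj'⟩
  · exact ⟨j, fun k hk => (hi k (hk.trans h)).trans (hj k hk), by rw [hi j h]; exact hj'⟩

lemma lexLt_tri {N : ℕ} (u v : Fin N → ℕ) : lexLt u v ∨ u = v ∨ lexLt v u := by
  by_cases h : u = v
  · exact Or.inr (Or.inl h)
  have hne : (Finset.univ.filter (fun k => u k ≠ v k)).Nonempty := by
    by_contra hc
    apply h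
    funext k
    by_contra hk
    exact hc ⟨k, by simp [hk]⟩
  obtain ⟨i, hi, hmin⟩ := Finset.exists_min_image _ id hne
  simp only [Finset.mem_filter, Finset.mem_univ, true_and, id] at hi hmin
  have hj : ∀ j, j < i → u j = v j := by
    intro j hj
    by_contra hc
    exact absurd (hmin j hc) (not_le.2 hj)
  rcases lt_or_gt_of_ne hi with h | h
  · exact Or.inl ⟨i, hj, h⟩
  · exact Or.inr (Or.inr ⟨i, fun j h => (hj j h).symm, h⟩)

lemma lexLt_add {N : ℕ} (u v c : Fin N → ℕ) : lexLt (u + c) (v + c) ↔ lexLt u v := by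
  simp [lexLt]

/-- a maximal element -/
lemma exists_lexmax {N : ℕ} (A : Finset (Fin N → ℕ)) (h : A.Nonempty) :
    ∃ u ∈ A, ∀ v ∈ A, ¬ lexLt u v := by
  obtain ⟨u, hu, hmin⟩ := Finset.exists_min_image A
    (fun u => (A.filter (fun v => lexLt u v)).card) h
  refine ⟨u, hu, fun v hv hlt => ?_⟩
  have := hmin v hv
  have h2 : (A.filter (fun w => lexLt v w)).card < (A.filter (fun w => lexLt u w)).card := by
    apply Finset.card_lt_card
    refine ⟨fun c hc => ?_, fun h => ?_⟩
    · simp only [Finset.mem_filter] at hc ⊢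
      exact ⟨hc.1, lexLt_trans hlt hc.2⟩
    · have : v ∈ A.filter (fun w => lexLt u w) := by simp [hv, hlt]
      have := h this
      simp [lexLt_irrefl] at this
  omega

lemma exists_lexmin {N : ℕ} (A : Finset (Fin N → ℕ)) (h : A.Nonempty) :
    ∃ u ∈ A, ∀ v ∈ A, ¬ lexLt v u := by
  obtain ⟨u, hu, hmin⟩ := Finset.exists_min_image A
    (fun u => (A.filter (fun v => lexLt v u)).card) h
  refine ⟨u, hu, fun v hv hlt => ?_⟩
  have := hmin v hv
  have h2 : (A.filter (fun w => lexLt w v)).card < (A.filter (fun w => lexLt w u)).card := by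
    apply Finset.card_lt_card
    refine ⟨fun c hc => ?_, fun h => ?_⟩
    · simp only [Finset.mem_filter] at hc ⊢
      exact ⟨hc.1, lexLt_trans hc.2 hlt⟩
    · have : v ∈ A.filter (fun w => lexLt w u) := by simp [hv, hlt]
      have := h this
      simp [lexLt_irrefl] at this
  omega

lemma lexSeg_isLexSeg {N : ℕ} (G : Finset (Fin N → ℕ)) (d : ℕ) : IsLexSeg G (lexSeg G d) := by
  refine ⟨Finset.filter_subset _ _, ?_⟩
  intro m hm v hv hlt
  simp only [lexSeg, Finset.mem_filter] at hm ⊢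
  refine ⟨hv, le_trans (Finset.card_le_card ?_) hm.2⟩
  intro x hx
  simp only [Finset.mem_filter] at hx ⊢
  refine ⟨hx.1, Or.inr ?_⟩
  rcases hx.2 with h | h
  · rwa [← h]
  · exact lexLt_trans hlt h

lemma lexSeg_card_le {N : ℕ} (G : Finset (Fin N → ℕ)) (d : ℕ) : (lexSeg G d).card ≤ d := by
  rcases (lexSeg G d).eq_empty_or_nonempty with h | h
  · simp [h]
  obtain ⟨u, hu, hmin⟩ := exists_lexmin _ h
  have hu' := hu
  simp only [lexSeg, Finset.mem_filter] at hu'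
  refine le_trans (Finset.card_le_card ?_) hu'.2
  intro x hx
  have := hmin x hx
  simp only [Finset.mem_filter]
  refine ⟨(lexSeg_isLexSeg G d).1 hx, ?_⟩
  rcases lexLt_tri u x with h | h | h
  · exact Or.inr h
  · exact Or.inl h
  · exact absurd h this

/-! ### Comparing with lex segments -/

def spb {N : ℕ} (r : ℕ) (m : Fin N → ℕ) : Prop := ∀ k : Fin N, r ≤ (k : ℕ) → m k = 0

def GG (N t q : ℕ) : Finset (Fin N → ℕ) := (degMon N t).filter (fun m => spb q m)

def aa {N : ℕ} (X : Finset (Fin N → ℕ)) (r : ℕ) : ℕ := (X.filter (fun m => spb r m)).card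

/-- pairs `(p, w)` with `p < q`, `w ∈ X` supported in `≤ p` -/
def PP {N : ℕ} (X : Finset (Fin N → ℕ)) (q : ℕ) : Finset (Σ _ : Fin N, (Fin N → ℕ)) :=
  (Finset.univ.filter (fun p : Fin N => (p : ℕ) < q)).sigma
    (fun p => X.filter (fun m => spb ((p : ℕ) + 1) m))

lemma card_PP {N : ℕ} (X : Finset (Fin N → ℕ)) (q : ℕ) :
    (PP X q).card = ∑ p ∈ Finset.univ.filter (fun p : Fin N => (p : ℕ) < q), aa X ((p : ℕ) + 1) := by
  simp [PP, aa, Finset.card_sigma]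

lemma mem_PP {N : ℕ} {X : Finset (Fin N → ℕ)} {q : ℕ} {p : Fin N} {w : Fin N → ℕ} :
    (⟨p, w⟩ : Σ _ : Fin N, (Fin N → ℕ)) ∈ PP X q ↔ (p : ℕ) < q ∧ w ∈ X ∧ spb ((p : ℕ) + 1) w := by
  simp [PP]

lemma PP_inj {N : ℕ} (X : Finset (Fin N → ℕ)) (q : ℕ) :
    Set.InjOn (fun x : (Σ _ : Fin N, (Fin N → ℕ)) => x.2 + ee x.1) (PP X q) := by
  have key : ∀ (p p' : Fin N) (w w' : Fin N → ℕ), spb ((p : ℕ) + 1) w → w + ee p = w' + ee p' →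
      ¬ p < p' := by
    intro p p' w w' hs h hlt
    have h1 := congrFun h p'
    have h2 := hs p' (by have : (p : ℕ) < p' := hlt
                         omega)
    simp [ee_apply, h2, hlt.ne'] at h1
  rintro ⟨p, w⟩ h1 ⟨p', w'⟩ h2 h
  have h1 := mem_PP.1 h1
  have h2 := mem_PP.1 h2
  simp only at h
  have e : p = p' := le_antisymm (not_lt.1 (key p' p w' w h2.2.2 h.symm))
    (not_lt.1 (key p p' w w' h1.2.2 h))
  subst e
  have : w = w' := add_ee_inj p h
  subst this
  rfl

lemma PP_le {N : ℕ} (X Y : Finset (Fin N → ℕ)) (q : ℕ)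
    (h : ∀ p (w : Fin N → ℕ), w ∈ X → (p : Fin N) < q → spb ((p : ℕ) + 1) w → w + ee p ∈ Y) :
    (PP X q).card ≤ Y.card := by
  apply Finset.card_le_card_of_injOn _ _ (PP_inj X q)
  rintro ⟨p, w⟩ hx
  have := mem_PP.1 hx
  exact h p w this.2.1 this.1 this.2.2

lemma le_PP {N : ℕ} (X Y : Finset (Fin N → ℕ)) (q : ℕ)
    (h : ∀ v ∈ Y, ∃ p : Fin N, ∃ w ∈ X, (p : ℕ) < q ∧ spb ((p : ℕ) + 1) w ∧ w + ee p = v) :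
    Y.card ≤ (PP X q).card := by
  apply Finset.card_le_card_of_surjOn (fun x : (Σ _ : Fin N, (Fin N → ℕ)) => x.2 + ee x.1)
  intro v hv
  obtain ⟨p, w, hw, hp, hs, he⟩ := h v hv
  exact ⟨⟨p, w⟩, mem_PP.2 ⟨hp, hw, hs⟩, he⟩

/-- every monomial of positive degree is `w * x_p` with `p` its last variable -/
lemma exists_last {N t : ℕ} (v : Fin N → ℕ) (hv : ∑ k, v k = t + 1) :
    ∃ p : Fin N, ∃ w, spb ((p : ℕ) + 1) w ∧ w + ee p = v := by
  have hne : (Finset.univ.filter (fun k => v k ≠ 0)).Nonempty := by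
    by_contra hc
    rw [Finset.not_nonempty_iff_eq_empty, Finset.filter_eq_empty_iff] at hc
    have : ∑ k, v k = 0 := Finset.sum_eq_zero (fun k hk => by simpa using hc hk)
    omega
  obtain ⟨p, hp, hmax⟩ := Finset.exists_max_image _ id hne
  simp only [Finset.mem_filter, Finset.mem_univ, true_and, id] at hp hmax
  refine ⟨p, fun k => v k - ee p k, ?_, ?_⟩
  · intro k hk
    have : v k = 0 := by
      by_contra hc
      have h2 : (k : ℕ) ≤ p := hmax k hc
      omega
    simp [this]
  · funext k
    by_cases h : k = p
    · subst h; simp [ee_apply]; omega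
    · simp [ee_apply, h]

lemma lex_key {N : ℕ} {w u : Fin N → ℕ} {p q : Fin N} (hs : ∑ k, w k = ∑ k, u k)
    (hw : spb ((p : ℕ) + 1) w) (hpq : p < q) (h : lexLt w u) : lexLt (w + ee p) (u + ee q) := by
  obtain ⟨i, hi, hi'⟩ := h
  rcases le_or_gt p i with hpi | hpi
  · exfalso
    have : ∑ k, w k < ∑ k, u k := by
      apply Finset.sum_lt_sum
      · intro k _
        rcases lt_trichotomy k i with hk | hk | hk
        · exact (hi k hk).le
        · subst hk; exact hi'.le
        · have h1 : (p : ℕ) < k := lt_of_le_of_lt hpi hk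
          rw [hw k h1]; omega
      · exact ⟨i, Finset.mem_univ _, hi'⟩
    omega
  · refine ⟨i, fun k hk => ?_, ?_⟩
    · simp [ee_apply, hi k hk, (hk.trans hpi).ne, (hk.trans (hpi.trans hpq)).ne]
    · simp [ee_apply, hpi.ne, (hpi.trans hpq).ne, hi']

lemma mem_GG {N t q : ℕ} {m : Fin N → ℕ} : m ∈ GG N t q ↔ ∑ k, m k = t ∧ spb q m := by
  simp [GG, mem_degMon]

def StabQ {N : ℕ} (q : ℕ) (M : Finset (Fin N → ℕ)) : Prop :=
  ∀ (w : Fin N → ℕ) (i j : Fin N), i < j → (j : ℕ) < q → w + ee j ∈ M → w + ee i ∈ M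

def col {N : ℕ} (q : Fin N) (M : Finset (Fin N → ℕ)) : Finset (Fin N → ℕ) :=
  (M.filter (fun m => m q ≠ 0)).image (fun m => fun k => m k - ee q k)

lemma sub_ee {N : ℕ} {q : Fin N} {m : Fin N → ℕ} (h : m q ≠ 0) :
    (fun k => m k - ee q k) + ee q = m := by
  funext k
  by_cases h' : k = q
  · subst h'; simp [ee_apply]; omega
  · simp [ee_apply, h']

lemma mem_col {N : ℕ} {q : Fin N} {M : Finset (Fin N → ℕ)} {w : Fin N → ℕ} :
    w ∈ col q M ↔ w + ee q ∈ M := by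
  simp only [col, Finset.mem_image, Finset.mem_filter]
  constructor
  · rintro ⟨a, ⟨ha, h⟩, rfl⟩
    rwa [sub_ee h]
  · intro h
    exact ⟨_, ⟨h, by simp [ee_apply]⟩, by funext k; simp⟩

lemma card_col {N : ℕ} (q : Fin N) (M : Finset (Fin N → ℕ)) :
    (col q M).card = (M.filter (fun m => m q ≠ 0)).card := by
  apply Finset.card_image_of_injOn
  intro a ha b hb h
  simp only [Finset.coe_filter, Set.mem_ofPred_eq] at ha hb
  rw [← sub_ee ha.2, ← sub_ee hb.2]
  simp only at h
  rw [h]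

lemma card_split {N t : ℕ} (q : Fin N) (M : Finset (Fin N → ℕ)) (hM : M ⊆ GG N t (q + 1)) :
    M.card = aa M q + (col q M).card := by
  rw [card_col, aa, ← Finset.card_filter_add_card_filter_not (s := M) (fun m => spb (q : ℕ) m)]
  congr 2
  apply Finset.filter_congr
  intro m hm
  have h1 := (mem_GG.1 (hM hm)).2
  apply not_congr
  constructor
  · intro h; exact h q le_rfl
  · intro h k hk
    rcases Nat.lt_or_ge q k with h2 | h2
    · exact h1 k h2
    · have : k = q := Fin.ext (by omega)
      rw [this, h]

lemma spb_add {N : ℕ} {r : ℕ} {w : Fin N → ℕ} {p : Fin N} :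
    spb r (w + ee p) ↔ spb r w ∧ (p : ℕ) < r := by
  constructor
  · intro h
    refine ⟨fun k hk => ?_, ?_⟩
    · have := h k hk; simp at this; exact this.1
    · by_contra hc
      have := h p (by omega)
      simp [ee_apply] at this
  · rintro ⟨h1, h2⟩ k hk
    have : k ≠ p := by rintro rfl; omega
    simp [h1 k hk, ee_apply, this]

lemma spb_mono {N : ℕ} {r s : ℕ} {w : Fin N → ℕ} (hrs : r ≤ s) (h : spb r w) : spb s w :=
  fun k hk => h k (hrs.trans hk)

lemma col_sub {N t : ℕ} {q : Fin N} {M : Finset (Fin N → ℕ)} (hM : M ⊆ GG N (t + 1) (q + 1)) :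
    col q M ⊆ GG N t (q + 1) := by
  intro w hw
  have := mem_GG.1 (hM (mem_col.1 hw))
  rw [sum_add_ee, spb_add] at this
  exact mem_GG.2 ⟨by omega, this.2.1⟩

/-- the key comparison theorem -/
theorem key_cmp (N t : ℕ) : ∀ q ≤ N, ∀ M L : Finset (Fin N → ℕ), M ⊆ GG N t q → StabQ q M →
    IsLexSeg (GG N t q) L → L.card ≤ M.card → ∀ r ≤ q, aa L r ≤ aa M r := by
  induction t with
  | zero =>
    intro q hq M L hM _ hL hc r hr
    have h0 : ∀ X ⊆ GG N 0 q, aa X r = X.card := by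
      intro X hX
      unfold aa
      rw [Finset.filter_true_of_mem]
      intro m hm k _
      have := (mem_GG.1 (hX hm)).1
      simp at this
      simp [this]
    rw [h0 M hM, h0 L hL.1]; exact hc
  | succ t ih =>
    intro q
    induction q with
    | zero =>
      intro _ M L hM _ hL hc r hr
      have h0 : ∀ X ⊆ GG N (t+1) 0, aa X r = X.card := by
        intro X hX
        unfold aa
        rw [Finset.filter_true_of_mem]
        intro m hm k _
        exact (mem_GG.1 (hX hm)).2 k (Nat.zero_le _)
      rw [h0 M hM, h0 L hL.1]; exact hc
    | succ q ihq =>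
      intro hq M L hM hSt hL hc r hr
      have hfull : ∀ X ⊆ GG N (t+1) (q+1), aa X (q+1) = X.card := by
        intro X hX
        unfold aa
        rw [Finset.filter_true_of_mem]
        intro m hm
        exact (mem_GG.1 (hX hm)).2
      rcases Nat.lt_or_ge q r with h | hrq
      · have : r = q + 1 := by omega
        subst this
        rw [hfull M hM, hfull L hL.1]; exact hc
      -- key step
      have key : aa L q ≤ aa M q := by
        by_contra hcon
        push Not at hcon
        obtain ⟨Q, hQ⟩ : ∃ Q : Fin N, (Q : ℕ) = q := ⟨⟨q, hq⟩, rfl⟩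
        subst hQ
        have s1 := card_split Q M hM
        have s2 := card_split Q L hL.1
        have hlt : (col Q L).card < (col Q M).card := by omega
        have hne : (GG N t (Q + 1) \ col Q L).Nonempty := by
          rw [← Finset.card_pos]
          have := Finset.le_card_sdiff (col Q L) (GG N t (Q+1))
          have := Finset.card_le_card (col_sub hM)
          omega
        obtain ⟨u, hu, humax⟩ := exists_lexmax _ hne
        rw [Finset.mem_sdiff] at hu
        have huG := mem_GG.1 hu.1
        have huL : u + ee Q ∉ L := fun h => hu.2 (mem_col.2 h)
        have huG' : u + ee Q ∈ GG N (t+1) (Q+1) := by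
          rw [mem_GG, sum_add_ee, spb_add]
          exact ⟨by omega, huG.2, by omega⟩
        have hUseg : IsLexSeg (GG N t (Q+1)) (insert u (col Q L)) := by
          refine ⟨Finset.insert_subset hu.1 (col_sub hL.1), ?_⟩
          intro m hm v hv hlt
          rw [Finset.mem_insert] at hm ⊢
          right
          rcases hm with rfl | hm
          · by_contra hc
            exact humax v (Finset.mem_sdiff.2 ⟨hv, hc⟩) hlt
          · rw [mem_col] at hm ⊢
            have hv' := mem_GG.1 hv
            refine hL.2 _ hm _ ?_ ((lexLt_add _ _ _).2 hlt)
            rw [mem_GG, sum_add_ee, spb_add]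
            exact ⟨by omega, hv'.2, by omega⟩
        have hstc : StabQ (Q+1) (col Q M) := by
          intro w i j hij hj hw
          rw [mem_col] at hw ⊢
          have := hSt (w + ee Q) i j hij hj (by rwa [add_right_comm])
          rwa [add_right_comm]
        have hI := ih (Q+1) hq (col Q M) (insert u (col Q L)) (col_sub hM) hstc hUseg
          (by rw [Finset.card_insert_of_notMem hu.2]; exact hlt)
        have c1 : (PP (col Q M) Q).card ≤ aa M Q := by
          apply PP_le
          intro p w hw hp hs
          rw [mem_col] at hw
          rw [Finset.mem_filter]
          exact ⟨hSt w p Q hp (by omega) hw, spb_add.2 ⟨spb_mono (by omega) hs, hp⟩⟩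
        have c2 : aa L Q ≤ (PP (insert u (col Q L)) Q).card := by
          apply le_PP
          intro v hv
          rw [Finset.mem_filter] at hv
          have hvG := mem_GG.1 (hL.1 hv.1)
          obtain ⟨p, w, hs, rfl⟩ := exists_last v hvG.1
          have hp := (spb_add.1 hv.2).2
          refine ⟨p, w, ?_, hp, hs, rfl⟩
          have hwsum : ∑ k, w k = t := by
            have := hvG.1
            rw [sum_add_ee] at this
            omega
          have hwG : w ∈ GG N t (Q+1) := mem_GG.2 ⟨hwsum, spb_mono (by omega) hs⟩
          rcases lexLt_tri w u with h | h | h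
          · exfalso
            apply huL
            exact hL.2 _ hv.1 _ huG' (lex_key (by omega) hs hp h)
          · simp [h]
          · exact hUseg.2 u (by simp) w hwG h
        rw [card_PP] at c1 c2
        have c3 : ∑ p ∈ Finset.univ.filter (fun p : Fin N => (p : ℕ) < Q),
            aa (insert u (col Q L)) ((p : ℕ) + 1) ≤
            ∑ p ∈ Finset.univ.filter (fun p : Fin N => (p : ℕ) < Q), aa (col Q M) ((p : ℕ) + 1) := by
          apply Finset.sum_le_sum
          intro p hp
          simp at hp
          have hp : (p : ℕ) < Q := hp
          exact hI _ (by omega)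
        omega
      -- restrict
      have hres : ∀ X : Finset (Fin N → ℕ), aa (X.filter (fun m => spb q m)) r = aa X r := by
        intro X
        unfold aa
        rw [Finset.filter_filter]
        congr 1
        apply Finset.filter_congr
        intro m _
        exact ⟨fun h => h.2, fun h => ⟨spb_mono hrq h, h⟩⟩
      rw [← hres M, ← hres L]
      apply ihq (by omega) _ _ _ _ _ key r hrq
      · intro m hm
        rw [Finset.mem_filter] at hm
        exact mem_GG.2 ⟨(mem_GG.1 (hM hm.1)).1, hm.2⟩
      · intro w i j hij hj hw
        rw [Finset.mem_filter, spb_add] at hw ⊢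
        have : (i : ℕ) < j := hij
        exact ⟨hSt w i j hij (by omega) hw.1, hw.2.1, by omega⟩
      · refine ⟨?_, ?_⟩
        · intro m hm
          rw [Finset.mem_filter] at hm
          exact mem_GG.2 ⟨(mem_GG.1 (hL.1 hm.1)).1, hm.2⟩
        · intro m hm v hv hlt
          rw [Finset.mem_filter] at hm ⊢
          have := mem_GG.1 hv
          exact ⟨hL.2 m hm.1 v (mem_GG.2 ⟨this.1, spb_mono (by omega) this.2⟩) hlt, this.2⟩

lemma lex_stab {N t : ℕ} {L : Finset (Fin N → ℕ)} (hL : IsLexSeg (degMon N t) L) : Stab L := by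
  intro w i j hij hw
  have h := mem_degMon.1 (hL.1 hw)
  rw [sum_add_ee] at h
  refine hL.2 _ hw _ (mem_degMon.2 (by rw [sum_add_ee]; exact h)) ⟨i, fun k hk => ?_, ?_⟩
  · simp [ee_apply, hk.ne, (hk.trans hij).ne]
  · simp [ee_apply, hij.ne]

/-- Macaulay's theorem for monomial sets -/
theorem macaulay {N t : ℕ} {M L : Finset (Fin N → ℕ)} (hM : M ⊆ degMon N t)
    (hL : IsLexSeg (degMon N t) L) (hc : L.card ≤ M.card) :
    (S1mul N L).card ≤ (S1mul N M).card := by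
  obtain ⟨A, hA, hAst, hAc, hAS⟩ := exists_stab M hM
  refine le_trans ?_ hAS
  have hG : GG N t N = degMon N t := by
    unfold GG
    rw [Finset.filter_true_of_mem]
    intro m _ k hk
    have := k.2
    omega
  have hI := key_cmp N t N le_rfl A L (by rw [hG]; exact hA)
    (fun w i j hij _ hw => hAst w i j hij hw) (by rw [hG]; exact hL) (by omega)
  have c1 : (PP A N).card ≤ (S1mul N A).card := by
    apply PP_le
    intro p w hw _ _
    exact mem_S1mul.2 ⟨p, w, hw, rfl⟩
  have c2 : (S1mul N L).card ≤ (PP L N).card := by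
    apply le_PP
    intro v hv
    have hvs := mem_degMon.1 (S1mul_sub hL.1 hv)
    obtain ⟨p, w, hs, rfl⟩ := exists_last v hvs
    refine ⟨p, w, ?_, p.2, hs, rfl⟩
    obtain ⟨k, m, hm, he⟩ := mem_S1mul.1 hv
    rcases lt_trichotomy k p with h | h | h
    · have hmp : m p ≠ 0 := by
        have := congrFun he p
        simp [ee_apply, h.ne'] at this
        omega
      rw [← sub_ee hmp] at hm he
      have := lex_stab hL _ k p h hm
      rw [add_right_comm] at he
      rwa [add_ee_inj p he] at this
    · subst h
      rwa [← add_ee_inj k he]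
    · exfalso
      have := congrFun he k
      have h2 := hs k (by have : (p : ℕ) < k := h
                          omega)
      simp [ee_apply, h.ne', h2] at this
  rw [card_PP] at c1 c2
  refine c2.trans (le_trans ?_ c1)
  apply Finset.sum_le_sum
  intro p _
  exact hI _ (by have := p.2; omega)

/-! ### Shifting degree -/

lemma S1mul_shift {N : ℕ} (X : Finset (Fin N → ℕ)) (c : Fin N → ℕ) :
    S1mul N (X.image (fun m => m + c)) = (S1mul N X).image (fun m => m + c) := by
  ext v
  simp only [mem_S1mul, Finset.mem_image]
  constructor
  · rintro ⟨i, _, ⟨m, hm, rfl⟩, rfl⟩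
    exact ⟨m + ee i, ⟨i, m, hm, rfl⟩, add_right_comm _ _ _⟩
  · rintro ⟨_, ⟨i, m, hm, rfl⟩, rfl⟩
    exact ⟨i, m + c, ⟨m, hm, rfl⟩, add_right_comm _ _ _⟩

lemma card_shift {N : ℕ} (X : Finset (Fin N → ℕ)) (c : Fin N → ℕ) :
    (X.image (fun m => m + c)).card = X.card :=
  Finset.card_image_of_injective _ (fun a b h => by simpa using h)

lemma sum_single {k : ℕ} (s : ℕ) : ∑ l, (Pi.single 0 s : Fin (k+1) → ℕ) l = s := by
  simp

lemma growth_le {k t : ℕ} {A : Finset (Fin (k+1) → ℕ)} (hA : A ⊆ degMon (k+1) t) :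
    growth A.card k ≤ (S1mul (k+1) A).card := by
  unfold growth
  set d := A.card with hd
  set L := lexSeg (degMon (k+1) d) d with hLdef
  have hL : IsLexSeg (degMon (k+1) d) L := lexSeg_isLexSeg _ _
  have hLc : L.card ≤ d := lexSeg_card_le _ _
  have e1 := card_shift (S1mul (k+1) L) (Pi.single 0 t)
  have e2 := card_shift (S1mul (k+1) A) (Pi.single 0 d)
  rw [← S1mul_shift] at e1 e2
  rw [← e1, ← e2]
  apply macaulay (t := t + d)
  · intro v hv
    obtain ⟨m, hm, rfl⟩ := Finset.mem_image.1 hv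
    have := mem_degMon.1 (hA hm)
    rw [mem_degMon]
    simp only [Pi.add_apply, Finset.sum_add_distrib, sum_single, this]
  · refine ⟨?_, ?_⟩
    · intro v hv
      obtain ⟨m, hm, rfl⟩ := Finset.mem_image.1 hv
      have := mem_degMon.1 (hL.1 hm)
      rw [mem_degMon]
      simp only [Pi.add_apply, Finset.sum_add_distrib, sum_single, this]
      omega
    · intro m' hm' v hv hlt
      obtain ⟨m, hm, rfl⟩ := Finset.mem_image.1 hm'
      have hv0 : t ≤ v 0 := by
        obtain ⟨i, hi, hi'⟩ := hlt
        by_cases h0 : i = 0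
        · subst h0; simp at hi'; omega
        · have := hi 0 (Fin.pos_of_ne_zero h0)
          simp at this; omega
      have hv2 : (fun l => v l - (Pi.single 0 t : Fin (k+1) → ℕ) l) + Pi.single 0 t = v := by
        funext l
        by_cases h : l = 0
        · subst h; simp; omega
        · simp [h]
      rw [← hv2] at hlt
      rw [lexLt_add] at hlt
      refine Finset.mem_image.2 ⟨_, hL.2 m hm _ ?_ hlt, hv2⟩
      have := mem_degMon.1 hv
      rw [← hv2] at this
      simp only [Pi.add_apply, Finset.sum_add_distrib, sum_single] at this
      rw [mem_degMon]
      omega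
  · rw [card_shift, card_shift]; exact hLc

/-- Let `M` be any set of degree-`t` monomials in `S` and
`d_i = |M^i|` (with `d_{-1} = 0`).  Then for every `0 ≤ i ≤ t + 1`,
`|(S_1·M)^i| ≥ max { d_i^{<n-2>}, d_{i-1} }`. -/
theorem stmt_8 (n t : ℕ) (hn : 2 ≤ n) (M : Finset (Fin n → ℕ)) (hM : M ⊆ degMon n t) :
    ∀ i : ℕ, i ≤ t + 1 →
      max (growth ((comp M i).card) (n - 2))
          (if i = 0 then 0 else (comp M (i - 1)).card)
        ≤ (comp (S1mul n M) i).card := by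
  intro i _
  obtain ⟨k, rfl⟩ : ∃ k, n = k + 2 := ⟨n - 2, by omega⟩
  have hx : ∀ m : Fin (k+2) → ℕ, x1exp m = m 0 := by
    intro m; simp [x1exp]
  apply max_le
  · have hcard : ((comp M i).image Fin.tail).card = (comp M i).card := by
      apply Finset.card_image_of_injOn
      intro a ha b hb h
      simp only [comp, Finset.coe_filter, Set.mem_ofPred_eq, hx] at ha hb
      rw [← Fin.cons_self_tail a, ← Fin.cons_self_tail b, h, ha.2, hb.2]
    have hsub : (comp M i).image Fin.tail ⊆ degMon (k+1) (t - i) := by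
      intro v hv
      obtain ⟨m, hm, rfl⟩ := Finset.mem_image.1 hv
      simp only [comp, Finset.mem_filter, hx] at hm
      have := mem_degMon.1 (hM hm.1)
      rw [Fin.sum_univ_succ] at this
      rw [mem_degMon]
      simp only [Fin.tail]
      omega
    have h := growth_le hsub
    rw [hcard] at h
    refine h.trans ?_
    apply Finset.card_le_card_of_injOn (fun v => (Fin.cons i v : Fin (k+2) → ℕ))
    · intro v hv
      obtain ⟨j, m', hm', rfl⟩ := mem_S1mul.1 hv
      obtain ⟨m, hm, rfl⟩ := Finset.mem_image.1 hm'
      simp only [comp, Finset.mem_filter, hx] at hm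
      simp only [comp, Finset.coe_filter, Set.mem_ofPred_eq, hx]
      refine ⟨mem_S1mul.2 ⟨j.succ, m, hm.1, ?_⟩, by simp⟩
      funext l
      refine Fin.cases ?_ (fun l => ?_) l
      · simp [ee_apply, hm.2, (Fin.succ_ne_zero j).symm]
      · simp [ee_apply, Fin.tail]
    · intro a _ b _ h
      exact (Fin.cons_injective2 h).2
  · split_ifs with h0
    · exact Nat.zero_le _
    · apply Finset.card_le_card_of_injOn (fun m => m + ee 0) _ ((add_ee_inj 0).injOn)
      intro m hm
      simp only [comp, Finset.coe_filter, Set.mem_ofPred_eq, hx] at hm ⊢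
      refine ⟨mem_S1mul.2 ⟨0, m, hm.1, rfl⟩, ?_⟩
      simp [ee_apply, hm.2]
      omega
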